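/- For every integer n ≥ 1, the metagraph H_n has exactly 4n+1 edges, and the Basu–Blanning projection of H_n over X'_n has exactly (n²+5n+2)/2 edges. -/

import Mathlib

/-- An edge of a metagraph: an invertex set and an outvertex set. -/
structure MEdge (α : Type*) where
  inv : Set α
  out : Set α

namespace MG

variable {α : Type*}

/-- `p` is a simple path from `x` to `y` using edges from `E`:
a nonempty sequence of edges of `E` with `x` in the invertex of the first edge,
`y` in the outvertex of the last edge, and consecutive edges sharing an element
(outvertex of one meets invertex of the next). -/
def IsSimplePath (E : Set (MEdge α)) (p : List (MEdge α)) (x y : α) : Prop :=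
  p ≠ [] ∧ (∀ e ∈ p, e ∈ E) ∧
  (∀ h : p ≠ [], x ∈ (p.head h).inv ∧ y ∈ (p.getLast h).out) ∧
  p.Chain' (fun e f => (e.out ∩ f.inv).Nonempty)

/-- Clauses (2) and (3) of the metapath definition: the pure inputs of `E'`
are contained in the source `B`, and the target `C` is covered by the union of
the outvertices. -/
def IsRelaxedMetapath (E : Set (MEdge α)) (B C : Set α) (E' : Set (MEdge α)) : Prop :=
  E' ⊆ E ∧
  ((⋃ e ∈ E', e.inv) \ (⋃ e ∈ E', e.out)) ⊆ B ∧
  C ⊆ ⋃ e ∈ E', e.out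

/-- Full metapath definition: clauses (2) and (3) together with clause (1),
that every edge of `E'` lies on a simple path (within `E'`) from some element
of `B` to some element of `C`. -/
def IsMetapath (E : Set (MEdge α)) (B C : Set α) (E' : Set (MEdge α)) : Prop :=
  IsRelaxedMetapath E B C E' ∧
  ∀ e ∈ E', ∃ (p : List (MEdge α)) (x y : α),
    x ∈ B ∧ y ∈ C ∧ e ∈ p ∧ IsSimplePath E' p x y

/-- Edge-dominance: no proper subset of `E'` is a metapath from `B` to `C`. -/
def IsEdgeDominant (E : Set (MEdge α)) (B C : Set α) (E' : Set (MEdge α)) : Prop :=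
  IsMetapath E B C E' ∧ ∀ F, F ⊂ E' → ¬ IsMetapath E B C F

/-- Input-dominance: there is no metapath from a proper subset of `B` to `C`. -/
def IsInputDominant (E : Set (MEdge α)) (B C : Set α) (E' : Set (MEdge α)) : Prop :=
  IsMetapath E B C E' ∧ ∀ B', B' ⊂ B → ∀ F, ¬ IsMetapath E B' C F

/-- Dominance: edge-dominant and input-dominant. -/
def IsDominant (E : Set (MEdge α)) (B C : Set α) (E' : Set (MEdge α)) : Prop :=
  IsEdgeDominant E B C E' ∧ IsInputDominant E B C E'

/-- Edge-dominance with respect to the relaxed metapath definition. -/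
def IsRelaxedEdgeDominant (E : Set (MEdge α)) (B C : Set α) (E' : Set (MEdge α)) : Prop :=
  IsRelaxedMetapath E B C E' ∧ ∀ F, F ⊂ E' → ¬ IsRelaxedMetapath E B C F

/-- Input-dominance with respect to the relaxed metapath definition. -/
def IsRelaxedInputDominant (E : Set (MEdge α)) (B C : Set α) (E' : Set (MEdge α)) : Prop :=
  IsRelaxedMetapath E B C E' ∧ ∀ B', B' ⊂ B → ∀ F, ¬ IsRelaxedMetapath E B' C F

/-- Dominance with respect to the relaxed metapath definition. -/
def IsRelaxedDominant (E : Set (MEdge α)) (B C : Set α) (E' : Set (MEdge α)) : Prop :=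
  IsRelaxedEdgeDominant E B C E' ∧ IsRelaxedInputDominant E B C E'

/-- Edge set of the Basu–Blanning projection of the metagraph with edge set `E`
over `X'`: for each invertex `V' ⊆ X'` of some dominant metapath `M(V',{x'})`
with `x' ∈ X'`, one edge `⟨V', W'⟩` where `W'` collects all such targets `x'`. -/
def BBP (E : Set (MEdge α)) (X' : Set α) : Set (MEdge α) :=
  { e | e.inv ⊆ X' ∧ (∃ x' ∈ X', ∃ M, IsDominant E e.inv {x'} M) ∧
        e.out = { x' | x' ∈ X' ∧ ∃ M, IsDominant E e.inv {x'} M } }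

/-- A metapath `M` with target `{x'}` is irreducible w.r.t. `X'` if no proper
subset of its edges forms a metapath `M(U,{x'})` with `U ⊆ X'`. -/
def Irreducible (E : Set (MEdge α)) (X' : Set α) (x' : α) (M : Set (MEdge α)) : Prop :=
  ¬ ∃ F, F ⊂ M ∧ ∃ U, U ⊆ X' ∧ IsMetapath E U {x'} F

/-- Edge set of the transitivity preserving projection of the metagraph with
edge set `E` over `X'`: as the Basu–Blanning projection, but collecting only
the irreducible dominant metapaths. -/
def TPP (E : Set (MEdge α)) (X' : Set α) : Set (MEdge α) :=
  { e | e.inv ⊆ X' ∧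
        (∃ x' ∈ X', ∃ M, IsDominant E e.inv {x'} M ∧ Irreducible E X' x' M) ∧
        e.out = { x' | x' ∈ X' ∧ ∃ M, IsDominant E e.inv {x'} M ∧ Irreducible E X' x' M } }

end MG

/-- Elements of the metagraphs `H_n`. -/
inductive Elt where
  | F0 : Elt
  | A : ℕ → Elt
  | B : ℕ → Elt
  | C : ℕ → Elt
  | D : ℕ → Elt
  | E : ℕ → Elt
deriving DecidableEq

/-- The generating set `X_n` of `H_n`. -/
def Xn (n : ℕ) : Set Elt :=
  {Elt.F0} ∪ {x | ∃ i ≤ n, x = Elt.A i ∨ x = Elt.B i} ∪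
    {x | ∃ i, 1 ≤ i ∧ i ≤ n ∧ (x = Elt.C i ∨ x = Elt.D i ∨ x = Elt.E i)}

/-- The edge set `E_n` of the metagraph `H_n`: the tail edge
`e_0 = ⟨{A_0,B_0},{F_0}⟩` together with, for each `1 ≤ i ≤ n`, the four edges
`e_{1,i} = ⟨{A_i},{C_i,D_i}⟩`, `e_{2,i} = ⟨{C_i},{A_{i-1}}⟩`,
`e_{3,i} = ⟨{B_i},{E_i}⟩`, `e_{4,i} = ⟨{D_i,E_i},{B_{i-1}}⟩`. -/
def En (n : ℕ) : Set (MEdge Elt) :=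
  {⟨{Elt.A 0, Elt.B 0}, {Elt.F0}⟩} ∪
  ⋃ i ∈ Set.Icc 1 n,
    ({⟨{Elt.A i}, {Elt.C i, Elt.D i}⟩,
      ⟨{Elt.C i}, {Elt.A (i - 1)}⟩,
      ⟨{Elt.B i}, {Elt.E i}⟩,
      ⟨{Elt.D i, Elt.E i}, {Elt.B (i - 1)}⟩} : Set (MEdge Elt))

/-- The projection set `X'_n = {A_i, B_i : 0 ≤ i ≤ n} ∪ {F_0}`. -/
def Xn' (n : ℕ) : Set Elt :=
  {Elt.F0} ∪ {x | ∃ i ≤ n, x = Elt.A i ∨ x = Elt.B i}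

namespace MG

variable {α : Type*} {E U : Set (MEdge α)} {B : Set α} {c x : α}

theorem isRelaxedMetapath_singleton_iff :
    IsRelaxedMetapath E B {c} U ↔ U ⊆ E ∧
      (∀ e ∈ U, ∀ x ∈ e.inv, x ∈ B ∨ ∃ f ∈ U, x ∈ f.out) ∧ ∃ f ∈ U, c ∈ f.out := by
  simp only [IsRelaxedMetapath, Set.subset_def, Set.mem_sdiff, Set.mem_iUnion, exists_prop,
    Set.mem_singleton_iff, forall_eq, and_imp, forall_exists_index]
  refine and_congr_right fun _ => and_congr_left fun _ => ⟨fun h e he x hx => ?_, ?_⟩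
  · by_contra! hc
    exact hc.1 (h x e he hx fun ⟨f, hf, hxf⟩ => hc.2 f hf hxf)
  · intro h x e he hx hn
    exact (h e he x hx).resolve_right hn

/-- `LeadsTo U c e` says that a simple path in `U` starts with `e` and ends in `c`. -/
inductive LeadsTo (U : Set (MEdge α)) (c : α) : MEdge α → Prop
  | last {e : MEdge α} : e ∈ U → c ∈ e.out → LeadsTo U c e
  | step {e f : MEdge α} : e ∈ U → (e.out ∩ f.inv).Nonempty → LeadsTo U c f → LeadsTo U c e

theorem LeadsTo.mem {e : MEdge α} (h : LeadsTo U c e) : e ∈ U := by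
  cases h <;> assumption

theorem LeadsTo.exists_isSimplePath {e : MEdge α} (h : LeadsTo U c e) :
    ∃ p, ∀ x ∈ e.inv, IsSimplePath {f | LeadsTo U c f} (e :: p) x c := by
  induction h with
  | @last e he hc =>
    refine ⟨[], fun x hx => ⟨by simp, ?_, fun _ => ⟨hx, hc⟩, List.isChain_singleton _⟩⟩
    simpa using LeadsTo.last he hc
  | @step e f he hef hf ih =>
    obtain ⟨p, hp⟩ := ih
    obtain ⟨y, -, hy⟩ := id hef
    obtain ⟨-, hmem, hends, hchain⟩ := hp y hy
    refine ⟨f :: p, fun x hx => ⟨by simp, ?_, fun _ => ⟨hx, ?_⟩, ?_⟩⟩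
    · exact List.forall_mem_cons.2 ⟨LeadsTo.step he hef hf, hmem⟩
    · simpa using (hends (by simp)).2
    · exact List.isChain_cons_cons.2 ⟨hef, hchain⟩

/-- In an acyclic metagraph all of whose edges have inputs, clauses (2) and (3) suffice for the
existence of a metapath. -/
theorem IsRelaxedMetapath.exists_isMetapath (r : α → ℕ)
    (hE : ∀ e ∈ E, e.inv.Nonempty ∧ ∀ x ∈ e.inv, ∀ y ∈ e.out, r x < r y)
    (h : IsRelaxedMetapath E B {c} U) : ∃ F, IsMetapath E B {c} F := by
  obtain ⟨hU, hin, f₀, hf₀, hcf₀⟩ := isRelaxedMetapath_singleton_iff.1 h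
  have hin' : ∀ e, LeadsTo U c e → ∀ x ∈ e.inv, x ∈ B ∨ ∃ f, LeadsTo U c f ∧ x ∈ f.out := by
    intro e he x hx
    refine (hin e he.mem x hx).imp_right ?_
    rintro ⟨f, hf, hxf⟩
    exact ⟨f, .step hf ⟨x, hxf, hx⟩ he, hxf⟩
  have extend : ∀ (N : ℕ) (e : MEdge α) (x : α) (p : List (MEdge α)), r x = N → e ∈ p →
      IsSimplePath {f | LeadsTo U c f} p x c →
      ∃ q, ∃ y ∈ B, e ∈ q ∧ IsSimplePath {f | LeadsTo U c f} q y c := by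
    intro N
    induction N using Nat.strong_induction_on with
    | _ N ih =>
      intro e x p hN hep hp
      obtain ⟨hne, hmem, hends, hchain⟩ := id hp
      rcases hin' _ (hmem _ (List.head_mem hne)) x (hends hne).1 with hx | ⟨f, hf, hxf⟩
      · exact ⟨p, x, hx, hep, hp⟩
      · obtain ⟨⟨y, hy⟩, hlt⟩ := hE f (hU hf.mem)
        refine ih (r y) (hN ▸ hlt y hy x hxf) e y (f :: p) rfl (List.mem_cons_of_mem _ hep)
          ⟨by simp, List.forall_mem_cons.2 ⟨hf, hmem⟩, fun _ => ⟨hy, ?_⟩, ?_⟩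
        · rw [List.getLast_cons hne]
          exact (hends hne).2
        · cases p with
          | nil => exact absurd rfl hne
          | cons g p => exact List.isChain_cons_cons.2 ⟨⟨x, hxf, (hends hne).1⟩, hchain⟩
  refine ⟨{f | LeadsTo U c f}, isRelaxedMetapath_singleton_iff.2
    ⟨fun e he => hU he.mem, hin', f₀, .last hf₀ hcf₀, hcf₀⟩, fun e he => ?_⟩
  obtain ⟨p, hp⟩ := LeadsTo.exists_isSimplePath he
  obtain ⟨x, hx⟩ := (hE e (hU he.mem)).1
  obtain ⟨q, y, hy, heq, hq⟩ := extend _ e x (e :: p) rfl (by simp) (hp x hx)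
  exact ⟨q, y, c, hy, rfl, heq, hq⟩

/-- If the source cannot be shrunk, some metapath is dominant. -/
theorem IsMetapath.exists_isDominant {C : Set α} (hfin : E.Finite) (h : IsMetapath E B C U)
    (hB : ∀ B', B' ⊂ B → ∀ F, ¬ IsMetapath E B' C F) : ∃ M, IsDominant E B C M := by
  have hS : {F | IsMetapath E B C F}.Finite :=
    hfin.finite_subsets.subset fun F hF => hF.1.1
  obtain ⟨M, hM⟩ := hS.exists_minimal ⟨U, h⟩
  exact ⟨M, ⟨hM.prop, fun F hF hmeta => hM.not_lt hmeta hF⟩, hM.prop, hB⟩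

theorem ncard_BBP (E : Set (MEdge α)) (X' : Set α) :
    (BBP E X').ncard = {V | V ⊆ X' ∧ ∃ x' ∈ X', ∃ M, IsDominant E V {x'} M}.ncard := by
  have hinj : Set.InjOn MEdge.inv (BBP E X') := by
    rintro ⟨V, W⟩ ⟨-, -, hW⟩ ⟨V', W'⟩ ⟨-, -, hW'⟩ (rfl : V = V')
    simp only at hW hW'
    rw [hW, hW']
  rw [← hinj.ncard_image]
  congr 1
  ext V
  constructor
  · rintro ⟨e, ⟨h₁, h₂, -⟩, rfl⟩
    exact ⟨h₁, h₂⟩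
  · rintro ⟨h₁, h₂⟩
    exact ⟨⟨V, {x' | x' ∈ X' ∧ ∃ M, IsDominant E V {x'} M}⟩, ⟨h₁, h₂, rfl⟩, rfl⟩

end MG

open MG

theorem mem_En {n : ℕ} {e : MEdge Elt} :
    e ∈ En n ↔ e = ⟨{Elt.A 0, Elt.B 0}, {Elt.F0}⟩ ∨ ∃ i, (1 ≤ i ∧ i ≤ n) ∧
      (e = ⟨{Elt.A i}, {Elt.C i, Elt.D i}⟩ ∨ e = ⟨{Elt.C i}, {Elt.A (i - 1)}⟩ ∨
        e = ⟨{Elt.B i}, {Elt.E i}⟩ ∨ e = ⟨{Elt.D i, Elt.E i}, {Elt.B (i - 1)}⟩) := by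
  simp [En]

theorem En_succ (n : ℕ) :
    En (n + 1) = insert ⟨{Elt.A (n + 1)}, {Elt.C (n + 1), Elt.D (n + 1)}⟩
      (insert ⟨{Elt.C (n + 1)}, {Elt.A n}⟩ (insert ⟨{Elt.B (n + 1)}, {Elt.E (n + 1)}⟩
        (insert ⟨{Elt.D (n + 1), Elt.E (n + 1)}, {Elt.B n}⟩ (En n)))) := by
  ext e
  simp only [Set.mem_insert_iff, mem_En]
  constructor
  · rintro (h | ⟨i, ⟨h₁, h₂⟩, h⟩)
    · simp [h]
    · rcases h₂.eq_or_lt with rfl | h₂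
      · simp only [Nat.add_sub_cancel] at h
        tauto
      · exact .inr (.inr (.inr (.inr (.inr ⟨i, ⟨h₁, by omega⟩, h⟩))))
  · rintro (h | h | h | h | h | ⟨i, ⟨h₁, h₂⟩, h⟩)
    · exact .inr ⟨n + 1, by omega, .inl h⟩
    · exact .inr ⟨n + 1, by omega, .inr (.inl h)⟩
    · exact .inr ⟨n + 1, by omega, .inr (.inr (.inl h))⟩
    · exact .inr ⟨n + 1, by omega, .inr (.inr (.inr h))⟩
    · exact .inl h
    · exact .inr ⟨i, ⟨h₁, by omega⟩, h⟩

theorem En_zero : En 0 = {⟨{Elt.A 0, Elt.B 0}, {Elt.F0}⟩} := by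
  ext e
  simp only [mem_En, Set.mem_singleton_iff, or_iff_left_iff_imp]
  rintro ⟨i, hi, -⟩
  omega

theorem En_finite (n : ℕ) : (En n).Finite := by
  induction n with
  | zero => simp [En_zero]
  | succ n ih => simpa [En_succ] using ih

theorem ncard_En (n : ℕ) : (En n).ncard = 4 * n + 1 := by
  induction n with
  | zero => simp [En_zero]
  | succ n ih =>
    have hne : ∀ e ∈ En n, ∀ x ∈ e.inv, x ≠ Elt.A (n + 1) ∧ x ≠ Elt.B (n + 1) ∧
        x ≠ Elt.C (n + 1) ∧ x ≠ Elt.D (n + 1) := by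
      intro e he x hx
      rcases mem_En.1 he with rfl | ⟨i, hi, rfl | rfl | rfl | rfl⟩ <;>
        simp only [Set.mem_insert_iff, Set.mem_singleton_iff] at hx <;>
        (try rcases hx with rfl | rfl) <;> simp <;> omega
    have hfin := En_finite n
    rw [En_succ, Set.ncard_insert_of_notMem _ (by simp [hfin]),
      Set.ncard_insert_of_notMem _ (by simp [hfin]),
      Set.ncard_insert_of_notMem _ (by simp [hfin]),
      Set.ncard_insert_of_notMem _ (by simp [hfin]), ih]
    · ring
    · exact fun h => (hne _ h (Elt.D (n + 1)) (by simp)).2.2.2 rfl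
    · rintro (h | h)
      · simpa using congrArg (Elt.B (n + 1) ∈ MEdge.inv ·) h
      · exact (hne _ h (Elt.B (n + 1)) rfl).2.1 rfl
    · rintro (h | h | h)
      iterate 2 · simpa using congrArg (Elt.C (n + 1) ∈ MEdge.inv ·) h
      exact (hne _ h (Elt.C (n + 1)) rfl).2.2.1 rfl
    · rintro (h | h | h | h)
      iterate 3 · simpa using congrArg (Elt.A (n + 1) ∈ MEdge.inv ·) h
      exact (hne _ h (Elt.A (n + 1)) rfl).1 rfl

/-- A rank function that increases along the edges of `H_n`. -/
def rankH (n : ℕ) : Elt → ℕ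
  | .F0 => 2 * n + 1
  | .A i => 2 * (n - i)
  | .B i => 2 * (n - i)
  | .C i => 2 * (n - i) + 1
  | .D i => 2 * (n - i) + 1
  | .E i => 2 * (n - i) + 1

theorem En_acyclic (n : ℕ) : ∀ e ∈ En n,
    e.inv.Nonempty ∧ ∀ x ∈ e.inv, ∀ y ∈ e.out, rankH n x < rankH n y := by
  intro e he
  rcases mem_En.1 he with rfl | ⟨i, hi, rfl | rfl | rfl | rfl⟩ <;>
    simp [rankH] <;> omega

/-- The part of `H_n` reachable from `{A_i, B_k}` apart from the tail edge. -/
def ladder (i k : ℕ) : Set (MEdge Elt) :=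
  {e | ∃ l, 1 ≤ l ∧
    ((l ≤ i ∧ (e = ⟨{Elt.A l}, {Elt.C l, Elt.D l}⟩ ∨ e = ⟨{Elt.C l}, {Elt.A (l - 1)}⟩)) ∨
     (l ≤ k ∧ (e = ⟨{Elt.B l}, {Elt.E l}⟩ ∨ e = ⟨{Elt.D l, Elt.E l}, {Elt.B (l - 1)}⟩)))}

section ladder

variable {i k l n : ℕ}

theorem ladder_subset_En (hi : i ≤ n) (hk : k ≤ n) : ladder i k ⊆ En n := by
  rintro e ⟨l, hl, (⟨h, h'⟩ | ⟨h, h'⟩)⟩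
  · exact mem_En.2 (.inr ⟨l, by omega, by tauto⟩)
  · exact mem_En.2 (.inr ⟨l, by omega, by tauto⟩)

theorem ladder_A (h : l < i) : ∃ f ∈ ladder i k, Elt.A l ∈ f.out :=
  ⟨⟨{Elt.C (l + 1)}, {Elt.A l}⟩, ⟨l + 1, by omega, .inl ⟨h, by simp⟩⟩, by simp⟩

theorem ladder_B (h : l < k) : ∃ f ∈ ladder i k, Elt.B l ∈ f.out :=
  ⟨⟨{Elt.D (l + 1), Elt.E (l + 1)}, {Elt.B l}⟩, ⟨l + 1, by omega, .inr ⟨h, by simp⟩⟩, by simp⟩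

theorem ladder_inv (hki : k ≤ i) : ∀ e ∈ ladder i k, ∀ x ∈ e.inv,
    (x = Elt.A i ∨ (0 < k ∧ x = Elt.B k)) ∨ ∃ f ∈ ladder i k, x ∈ f.out := by
  have hCD : ∀ l, 1 ≤ l → l ≤ i → ∀ x, x = Elt.C l ∨ x = Elt.D l →
      ∃ f ∈ ladder i k, x ∈ f.out := fun l h₁ h₂ x hx =>
    ⟨_, ⟨l, h₁, .inl ⟨h₂, .inl rfl⟩⟩, hx⟩
  rintro e ⟨l, hl, (⟨h, rfl | rfl⟩ | ⟨h, rfl | rfl⟩)⟩ x hx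
  · obtain rfl : x = Elt.A l := hx
    rcases h.eq_or_lt with rfl | h
    · simp
    · exact .inr (ladder_A h)
  · exact .inr (hCD l hl h x (.inl hx))
  · obtain rfl : x = Elt.B l := hx
    rcases h.eq_or_lt with rfl | h
    · exact .inl (.inr ⟨hl, rfl⟩)
    · exact .inr (ladder_B h)
  · rcases hx with hx | hx
    · exact .inr (hCD l hl (h.trans hki) x (.inr hx))
    · exact .inr ⟨_, ⟨l, hl, .inr ⟨h, .inl rfl⟩⟩, hx⟩

theorem exists_isMetapath_A (hl : l < i) (hi : i ≤ n) :
    ∃ F, IsMetapath (En n) {Elt.A i} {Elt.A l} F := by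
  refine IsRelaxedMetapath.exists_isMetapath (U := ladder i 0) (rankH n) (En_acyclic n)
    (isRelaxedMetapath_singleton_iff.2
      ⟨ladder_subset_En hi (by omega), fun e he x hx => ?_, ladder_A hl⟩)
  simpa using ladder_inv (Nat.zero_le i) e he x hx

theorem exists_isMetapath_B (hl : l < k) (hki : k ≤ i) (hi : i ≤ n) :
    ∃ F, IsMetapath (En n) {Elt.A i, Elt.B k} {Elt.B l} F := by
  refine IsRelaxedMetapath.exists_isMetapath (U := ladder i k) (rankH n) (En_acyclic n)
    (isRelaxedMetapath_singleton_iff.2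
      ⟨ladder_subset_En hi (by omega), fun e he x hx => ?_, ladder_B hl⟩)
  exact (ladder_inv hki e he x hx).imp_left fun h => h.imp_right And.right

theorem exists_isMetapath_F0 (hki : k ≤ i) (hi : i ≤ n) :
    ∃ F, IsMetapath (En n) {Elt.A i, Elt.B k} {Elt.F0} F := by
  refine IsRelaxedMetapath.exists_isMetapath
    (U := insert ⟨{Elt.A 0, Elt.B 0}, {Elt.F0}⟩ (ladder i k)) (rankH n) (En_acyclic n)
    (isRelaxedMetapath_singleton_iff.2 ⟨Set.insert_subset (mem_En.2 (.inl rfl))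
      (ladder_subset_En hi (by omega)), ?_, _, Set.mem_insert _ _, by simp⟩)
  have key : ∀ x, (∃ f ∈ ladder i k, x ∈ f.out) → ∃ f ∈
      insert (⟨{Elt.A 0, Elt.B 0}, {Elt.F0}⟩ : MEdge Elt) (ladder i k), x ∈ f.out :=
    fun x ⟨f, hf, hx⟩ => ⟨f, Set.mem_insert_of_mem _ hf, hx⟩
  rintro e (rfl | he) x hx
  · rcases hx with rfl | hx
    · rcases i.eq_zero_or_pos with rfl | h
      · simp
      · exact .inr (key _ (ladder_A h))
    · obtain rfl : x = Elt.B 0 := hx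
      rcases k.eq_zero_or_pos with rfl | h
      · simp
      · exact .inr (key _ (ladder_B h))
  · exact (ladder_inv hki e he x hx).imp (fun h => h.imp_right And.right) (key x)

end ladder

section inputs

variable {n : ℕ} {V : Set Elt} {M : Set (MEdge Elt)}

/-- The only edges producing a given element. -/
theorem mem_out_En {e : MEdge Elt} (he : e ∈ En n) :
    (Elt.F0 ∈ e.out → e = ⟨{Elt.A 0, Elt.B 0}, {Elt.F0}⟩) ∧
    ∀ i, (Elt.A i ∈ e.out → i < n ∧ e = ⟨{Elt.C (i + 1)}, {Elt.A i}⟩) ∧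
      (Elt.B i ∈ e.out → i < n ∧ e = ⟨{Elt.D (i + 1), Elt.E (i + 1)}, {Elt.B i}⟩) ∧
      ((Elt.C i ∈ e.out ∨ Elt.D i ∈ e.out) → e = ⟨{Elt.A i}, {Elt.C i, Elt.D i}⟩) ∧
      (Elt.E i ∈ e.out → e = ⟨{Elt.B i}, {Elt.E i}⟩) := by
  rcases mem_En.1 he with rfl | ⟨l, hl, rfl | rfl | rfl | rfl⟩
  · simp
  · simp
  · obtain ⟨m, rfl⟩ : ∃ m, l = m + 1 := ⟨l - 1, by omega⟩
    simp
    grind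
  · simp
  · obtain ⟨m, rfl⟩ : ∃ m, l = m + 1 := ⟨l - 1, by omega⟩
    simp
    grind

variable (hM : M ⊆ En n) (hV : V ⊆ Xn' n)
  (hin : ∀ e ∈ M, ∀ x ∈ e.inv, x ∈ V ∨ ∃ f ∈ M, x ∈ f.out)
include hM hV hin

theorem exists_input_A (j : ℕ) (h : ∃ f ∈ M, Elt.A j ∈ f.out) :
    ∃ i, j < i ∧ i ≤ n ∧ Elt.A i ∈ V := by
  induction hd : n - j generalizing j with
  | zero =>
    obtain ⟨f, hf, hA⟩ := h
    have := (((mem_out_En (hM hf)).2 j).1 hA).1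
    omega
  | succ d ih =>
    obtain ⟨f, hf, hA⟩ := h
    obtain ⟨hj, rfl⟩ := ((mem_out_En (hM hf)).2 j).1 hA
    rcases hin _ hf (Elt.C (j + 1)) rfl with hC | ⟨g, hg, hC⟩
    · simpa [Xn'] using hV hC
    · obtain rfl := ((mem_out_En (hM hg)).2 (j + 1)).2.2.1 (.inl hC)
      rcases hin _ hg (Elt.A (j + 1)) rfl with hA' | hA'
      · exact ⟨j + 1, by omega, hj, hA'⟩
      · obtain ⟨i, h₁, h₂, h₃⟩ := ih (j + 1) hA' (by omega)
        exact ⟨i, by omega, h₂, h₃⟩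

theorem exists_input_A_of_mem_inv {j : ℕ} (hj : j ≤ n) (h : ∃ e ∈ M, Elt.A j ∈ e.inv) :
    ∃ i, j ≤ i ∧ i ≤ n ∧ Elt.A i ∈ V := by
  obtain ⟨e, he, hA⟩ := h
  rcases hin e he _ hA with hA | hA
  · exact ⟨j, le_rfl, hj, hA⟩
  · obtain ⟨i, h₁, h₂, h₃⟩ := exists_input_A hM hV hin j hA
    exact ⟨i, h₁.le, h₂, h₃⟩

theorem exists_input_B (j : ℕ) (h : ∃ f ∈ M, Elt.B j ∈ f.out) :
    ∃ k i, j < k ∧ k ≤ i ∧ i ≤ n ∧ Elt.A i ∈ V ∧ Elt.B k ∈ V := by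
  induction hd : n - j generalizing j with
  | zero =>
    obtain ⟨f, hf, hB⟩ := h
    have := (((mem_out_En (hM hf)).2 j).2.1 hB).1
    omega
  | succ d ih =>
    obtain ⟨f, hf, hB⟩ := h
    obtain ⟨hj, rfl⟩ := ((mem_out_En (hM hf)).2 j).2.1 hB
    rcases hin _ hf (Elt.D (j + 1)) (.inl rfl) with hD | ⟨g, hg, hD⟩
    · simpa [Xn'] using hV hD
    rcases hin _ hf (Elt.E (j + 1)) (.inr rfl) with hE | ⟨g', hg', hE⟩
    · simpa [Xn'] using hV hE
    obtain rfl := ((mem_out_En (hM hg)).2 (j + 1)).2.2.1 (.inr hD)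
    obtain rfl := ((mem_out_En (hM hg')).2 (j + 1)).2.2.2 hE
    rcases hin _ hg' (Elt.B (j + 1)) rfl with hB' | hB'
    · obtain ⟨i, h₁, h₂, h₃⟩ := exists_input_A_of_mem_inv hM hV hin hj ⟨_, hg, rfl⟩
      exact ⟨j + 1, i, by omega, h₁, h₂, h₃, hB'⟩
    · obtain ⟨k, i, h₁, h₂⟩ := ih (j + 1) hB' (by omega)
      exact ⟨k, i, by omega, h₂⟩

theorem exists_input_F0 (h : ∃ f ∈ M, Elt.F0 ∈ f.out) :
    ∃ k i, k ≤ i ∧ i ≤ n ∧ Elt.A i ∈ V ∧ Elt.B k ∈ V := by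
  obtain ⟨f, hf, hF⟩ := h
  obtain rfl := (mem_out_En (hM hf)).1 hF
  rcases hin _ hf (Elt.B 0) (.inr rfl) with hB | hB
  · obtain ⟨i, h₁, h₂, h₃⟩ :=
      exists_input_A_of_mem_inv hM hV hin n.zero_le ⟨_, hf, .inl rfl⟩
    exact ⟨0, i, h₁, h₂, h₃, hB⟩
  · obtain ⟨k, i, -, h⟩ := exists_input_B hM hV hin 0 hB
    exact ⟨k, i, h⟩

end inputs

/-- The invertices of the Basu–Blanning projection of `H_n` over `X'_n`. -/
def sources (n : ℕ) : Set (Set Elt) :=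
  {V | ∃ i, 1 ≤ i ∧ i ≤ n ∧ V = {Elt.A i}} ∪
    {V | ∃ k i, k ≤ i ∧ i ≤ n ∧ V = {Elt.A i, Elt.B k}}

theorem exists_source {n : ℕ} {V : Set Elt} {x : Elt} {M : Set (MEdge Elt)}
    (hV : V ⊆ Xn' n) (hx : x ∈ Xn' n) (h : IsMetapath (En n) V {x} M) :
    ∃ W ∈ sources n, W ⊆ V ∧ ∃ F, IsMetapath (En n) W {x} F := by
  obtain ⟨hM, hin, hout⟩ := isRelaxedMetapath_singleton_iff.1 h.1
  rcases hx with rfl | ⟨j, -, rfl | rfl⟩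
  · obtain ⟨k, i, hki, hi, hA, hB⟩ := exists_input_F0 hM hV hin hout
    exact ⟨_, .inr ⟨k, i, hki, hi, rfl⟩, Set.pair_subset hA hB, exists_isMetapath_F0 hki hi⟩
  · obtain ⟨i, hj, hi, hA⟩ := exists_input_A hM hV hin j hout
    exact ⟨_, .inl ⟨i, by omega, hi, rfl⟩, Set.singleton_subset_iff.2 hA,
      exists_isMetapath_A hj hi⟩
  · obtain ⟨k, i, hj, hki, hi, hA, hB⟩ := exists_input_B hM hV hin j hout
    exact ⟨_, .inr ⟨k, i, hki, hi, rfl⟩, Set.pair_subset hA hB, exists_isMetapath_B hj hki hi⟩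

theorem exists_isDominant_iff_mem_sources {n : ℕ} {V : Set Elt} :
    (V ⊆ Xn' n ∧ ∃ x ∈ Xn' n, ∃ M, IsDominant (En n) V {x} M) ↔ V ∈ sources n := by
  constructor
  · rintro ⟨hV, x, hx, M, hM⟩
    obtain ⟨W, hW, hWV, F, hF⟩ := exists_source hV hx hM.1.1
    rcases hWV.eq_or_ssubset with rfl | hss
    · exact hW
    · exact absurd hF (hM.2.2 W hss F)
  · rintro (⟨i, h₁, hi, rfl⟩ | ⟨k, i, hki, hi, rfl⟩)
    · have hV : {Elt.A i} ⊆ Xn' n := Set.singleton_subset_iff.2 (.inr ⟨i, hi, .inl rfl⟩)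
      obtain ⟨F, hF⟩ := exists_isMetapath_A (n := n) (l := 0) h₁ hi
      refine ⟨hV, Elt.A 0, .inr ⟨0, n.zero_le, .inl rfl⟩,
        hF.exists_isDominant (En_finite n) fun B' hB' G hG => ?_⟩
      obtain ⟨hM, hin, hout⟩ := isRelaxedMetapath_singleton_iff.1 hG.1
      obtain ⟨j, -, -, hj⟩ := exists_input_A hM (hB'.subset.trans hV) hin 0 hout
      rw [Set.ssubset_singleton_iff.1 hB'] at hj
      exact hj
    · have hV : {Elt.A i, Elt.B k} ⊆ Xn' n := Set.pair_subset (.inr ⟨i, hi, .inl rfl⟩)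
        (.inr ⟨k, by omega, .inr rfl⟩)
      obtain ⟨F, hF⟩ := exists_isMetapath_F0 hki hi
      refine ⟨hV, Elt.F0, .inl rfl,
        hF.exists_isDominant (En_finite n) fun B' hB' G hG => hB'.not_subset ?_⟩
      obtain ⟨hM, hin, hout⟩ := isRelaxedMetapath_singleton_iff.1 hG.1
      obtain ⟨k', i', -, -, hA, hB⟩ := exists_input_F0 hM (hB'.subset.trans hV) hin hout
      obtain rfl : i' = i := by simpa using hB'.subset hA
      obtain rfl : k' = k := by simpa using hB'.subset hB
      exact Set.pair_subset hA hB

theorem ncard_sources (n : ℕ) : (sources n).ncard = (n ^ 2 + 5 * n + 2) / 2 := by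
  let s : Finset ℕ := Finset.Icc 1 n
  let t : Finset (Σ _ : ℕ, ℕ) := (Finset.range (n + 1)).sigma fun i => Finset.range (i + 1)
  let f : ℕ → Set Elt := fun i => {Elt.A i}
  let g : (Σ _ : ℕ, ℕ) → Set Elt := fun p => {Elt.A p.1, Elt.B p.2}
  have hs : {V | ∃ i, 1 ≤ i ∧ i ≤ n ∧ V = {Elt.A i}} = f '' s := by
    ext V
    simp [s, f, and_assoc, eq_comm]
  have ht : {V | ∃ k i, k ≤ i ∧ i ≤ n ∧ V = {Elt.A i, Elt.B k}} = g '' t := by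
    ext V
    simp only [Set.mem_ofPred_eq, Set.mem_image, Finset.mem_coe, Finset.mem_sigma,
      Finset.mem_range, Nat.lt_succ_iff, Sigma.exists, t, g]
    grind
  have hf : f.Injective := fun i j h => by simpa [f] using h
  have hg : g.Injective := by
    rintro ⟨i, k⟩ ⟨i', k'⟩ h
    have h₁ : Elt.A i ∈ g ⟨i', k'⟩ := h ▸ Set.mem_insert _ _
    have h₂ : Elt.B k ∈ g ⟨i', k'⟩ := h ▸ Set.mem_insert_of_mem _ rfl
    simp_all [g]
  have hdisj : Disjoint (f '' s) (g '' t) := by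
    rw [Set.disjoint_left]
    rintro _ ⟨i, -, rfl⟩ ⟨p, -, h⟩
    have : Elt.B p.2 ∈ f i := h ▸ Set.mem_insert_of_mem _ rfl
    simp [f] at this
  have hgauss := Finset.sum_range_id_mul_two (n + 2)
  rw [Finset.sum_range_succ'] at hgauss
  have htcard : t.card * 2 = (n + 2) * (n + 1) := by
    simpa [t, Finset.card_sigma] using hgauss
  rw [sources, hs, ht, Set.ncard_union_eq hdisj, Set.ncard_image_of_injective _ hf,
    Set.ncard_image_of_injective _ hg, Set.ncard_coe_finset, Set.ncard_coe_finset, Nat.card_Icc]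
  have : n ^ 2 + 5 * n + 2 = (n + t.card) * 2 := by linear_combination -htcard
  omega

/-- For every `n ≥ 1`, the metagraph `H_n` has exactly `4n+1` edges and its
Basu–Blanning projection over `X'_n` has exactly `(n² + 5n + 2)/2` edges. -/
theorem stmt_0 (n : ℕ) (hn : 1 ≤ n) :
    (En n).ncard = 4 * n + 1 ∧
    (MG.BBP (En n) (Xn' n)).ncard = (n ^ 2 + 5 * n + 2) / 2 := by
  refine ⟨ncard_En n, ?_⟩
  rw [ncard_BBP, ← ncard_sources]
  simp_rw [exists_isDominant_iff_mem_sources, Set.ofPred_mem_eq]
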